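/- arXiv:2405.05950 — 4 statements merged into one kernel-verified Lean document; each statement's English description precedes it below -/
import Mathlib

section
/- Let Ω be a finite type, let f : Finset Ω → ℝ be submodular, let f̄ : Finset Ω → ℝ be a ξ-controlled estimation of f for some ξ ≥ 0, let k be a positive natural number, let S ⊆ Ω be a finite set, let O ⊆ Ω be a finite set with |O| ≤ k, and let V ⊆ Ω be a set of k elements whose estimated marginal gains dominate all others, i.e. f̄(S ∪ {v}) − f̄(S) ≥ f̄(S ∪ {u}) − f̄(S) for every v ∈ V and u ∈ Ω \ V. Then Σ_{v ∈ V} max{ f̄(S ∪ {v}) − f̄(S), 0 } ≥ f(O ∪ S) − f(S) − 2·k·ξ. (This is the displayed chain of inequalities in the resilience analysis of RandomSampling, Lemma E.4.) -/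
/-- A set function on a finite ground set is submodular if for all `A ⊆ B` and `v ∉ B`,
`f (A ∪ {v}) - f A ≥ f (B ∪ {v}) - f B`. -/
def Submodular {Ω : Type*} [DecidableEq Ω] [Fintype Ω] (f : Finset Ω → ℝ) : Prop :=
  ∀ A B : Finset Ω, A ⊆ B → ∀ v ∉ B, f (insert v B) - f B ≤ f (insert v A) - f A

/-- `f̄` is a `ξ`-controlled estimation of `f` if `|f A - f̄ A| ≤ ξ` for every `A`. -/
def ControlledEstimation {Ω : Type*} [DecidableEq Ω] [Fintype Ω]
    (f fbar : Finset Ω → ℝ) (ξ : ℝ) : Prop :=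
  ∀ A : Finset Ω, |f A - fbar A| ≤ ξ

theorem Finset.sum_le_sum_of_dominating {Ω : Type*} [DecidableEq Ω] (h : Ω → ℝ)
    (hnn : ∀ x, 0 ≤ h x) (O V : Finset Ω) (hcard : O.card ≤ V.card)
    (hdom : ∀ v ∈ V, ∀ u ∉ V, h u ≤ h v) : ∑ x ∈ O, h x ≤ ∑ x ∈ V, h x := by
  have hdiff : (O \ V).card ≤ (V \ O).card := by
    have h1 := Finset.card_sdiff_add_card_inter O V
    have h2 := Finset.card_sdiff_add_card_inter V O
    rw [Finset.inter_comm] at h2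
    omega
  have key : ∑ x ∈ O \ V, h x ≤ ∑ x ∈ V \ O, h x := by
    rcases (V \ O).eq_empty_or_nonempty with he | hne
    · have hO : O \ V = ∅ := by simpa [he] using hdiff
      rw [he, hO]
    · obtain ⟨m, hm, hmin⟩ := Finset.exists_min_image (V \ O) h hne
      calc ∑ x ∈ O \ V, h x ≤ (O \ V).card • h m :=
            Finset.sum_le_card_nsmul _ _ _ fun x hx =>
              hdom m (Finset.mem_sdiff.1 hm).1 x (Finset.mem_sdiff.1 hx).2
        _ ≤ (V \ O).card • h m := nsmul_le_nsmul_left (hnn m) hdiff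
        _ ≤ ∑ x ∈ V \ O, h x := Finset.card_nsmul_le_sum _ _ _ hmin
  have h1 := Finset.sum_inter_add_sum_sdiff O V h
  have h2 := Finset.sum_inter_add_sum_sdiff V O h
  rw [Finset.inter_comm] at h2
  linarith

theorem Submodular.union_sub_le_sum {Ω : Type*} [DecidableEq Ω] [Fintype Ω]
    {f : Finset Ω → ℝ} (hf : Submodular f) (S O : Finset Ω) :
    f (O ∪ S) - f S ≤ ∑ o ∈ O, (f (insert o S) - f S) := by
  induction O using Finset.induction_on with
  | empty => simp
  | insert a T ha ih =>
    rw [Finset.sum_insert ha, Finset.insert_union]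
    by_cases haS : a ∈ S
    · rw [Finset.insert_eq_of_mem (Finset.mem_union_right T haS), Finset.insert_eq_of_mem haS]
      linarith
    · have := hf S (T ∪ S) Finset.subset_union_right a (by simp [ha, haS])
      linarith

theorem stmt_9 {Ω : Type*} [DecidableEq Ω] [Fintype Ω]
    (f fbar : Finset Ω → ℝ) (ξ : ℝ) (hξ : 0 ≤ ξ)
    (hf : Submodular f) (hbar : ControlledEstimation f fbar ξ)
    (k : ℕ) (hk : 0 < k)
    (S O V : Finset Ω) (hO : O.card ≤ k) (hV : V.card = k)
    (htop : ∀ v ∈ V, ∀ u ∉ V, fbar (insert u S) - fbar S ≤ fbar (insert v S) - fbar S) :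
    f (O ∪ S) - f S - 2 * k * ξ ≤ ∑ v ∈ V, max (fbar (insert v S) - fbar S) 0 := by
  have hmarg : ∀ o, f (insert o S) - f S ≤ max (fbar (insert o S) - fbar S) 0 + 2 * ξ := by
    intro o
    have h1 := (abs_le.1 (hbar (insert o S))).2
    have h2 := (abs_le.1 (hbar S)).1
    have h3 := le_max_left (fbar (insert o S) - fbar S) 0
    linarith
  have hdom := Finset.sum_le_sum_of_dominating (fun x => max (fbar (insert x S) - fbar S) 0)
    (fun x => le_max_right _ _) O V (hO.trans hV.ge)
    fun v hv u hu => max_le_max_right 0 (htop v hv u hu)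
  have hsum := Finset.sum_le_sum fun o (_ : o ∈ O) => hmarg o
  rw [Finset.sum_add_distrib, Finset.sum_const, nsmul_eq_mul] at hsum
  have hcard : (O.card : ℝ) * (2 * ξ) ≤ k * (2 * ξ) := by gcongr
  linarith [hf.union_sub_le_sum S O]
end

section
/- Let Ω be a finite type, let f : Finset Ω → ℝ be submodular, let f̄ : Finset Ω → ℝ be a ξ-controlled estimation of f for some ξ ≥ 0, and let S, O ⊆ Ω be finite sets. Then Σ_{u ∈ O} max{ f̄(S ∪ {u}) − f̄(S), 0 } ≥ f(O ∪ S) − f(S) − 2·|O|·ξ. -/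
theorem stmt_11 {Ω : Type*} [DecidableEq Ω] [Fintype Ω]
    (f fbar : Finset Ω → ℝ) (ξ : ℝ) (hξ : 0 ≤ ξ)
    (hf : Submodular f) (hbar : ControlledEstimation f fbar ξ)
    (S O : Finset Ω) :
    f (O ∪ S) - f S - 2 * O.card * ξ ≤ ∑ u ∈ O, max (fbar (insert u S) - fbar S) 0 := by
  induction O using Finset.induction_on with
  | empty => simp
  | insert a O ha ih =>
    rw [Finset.sum_insert ha, Finset.card_insert_of_notMem ha, Finset.insert_union]
    push_cast
    have hmax : fbar (insert a S) - fbar S ≤ max (fbar (insert a S) - fbar S) 0 := le_max_left _ _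
    have hmax0 : 0 ≤ max (fbar (insert a S) - fbar S) 0 := le_max_right _ _
    by_cases haOS : a ∈ O ∪ S
    · rw [Finset.insert_eq_of_mem haOS]
      linarith
    · have hmarginal := hf S (O ∪ S) Finset.subset_union_right a haOS
      have hinsert := (abs_le.mp (hbar (insert a S))).2
      have hbase := (abs_le.mp (hbar S)).1
      linarith
end

section
/- Let k be a positive natural number, let F ≥ 0, ε ≥ 0, ξ ≥ 0 be reals, and let a : ℕ → ℝ satisfy a(0) ≥ 0 and, for every i with 1 ≤ i ≤ k, a(i) ≥ a(i−1) + ( ((1 − 1/k)^{i−1} − ε)·F − a(i−1) )/k − 4·ξ. Then for every i with 1 ≤ i ≤ k, a(i) ≥ (i/k)·((1 − 1/k)^{i−1} − ε)·F − 4·i·ξ. (This is the induction at the heart of the resilience proof of RandomSampling, Lemma E.4, with a(i) = E[f(S_i)] and F = f(OPT).) -/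
theorem stmt_13 (k : ℕ) (hk : 0 < k)
    (F ε ξ : ℝ) (hF : 0 ≤ F) (hε : 0 ≤ ε) (hξ : 0 ≤ ξ)
    (a : ℕ → ℝ) (ha0 : 0 ≤ a 0)
    (hrec : ∀ i : ℕ, 1 ≤ i → i ≤ k →
      a (i - 1) + (((1 - 1 / (k : ℝ)) ^ (i - 1) - ε) * F - a (i - 1)) / k - 4 * ξ ≤ a i) :
    ∀ i : ℕ, 1 ≤ i → i ≤ k →
      ((i : ℝ) / k) * ((1 - 1 / (k : ℝ)) ^ (i - 1) - ε) * F - 4 * i * ξ ≤ a i := by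
  have hk1 : (1 : ℝ) ≤ k := by exact_mod_cast hk
  have hr0 : 0 ≤ 1 / (k : ℝ) := by positivity
  have hr1 : 1 / (k : ℝ) ≤ 1 := (div_le_one (by linarith)).2 hk1
  simp only [div_eq_mul_inv, one_mul] at hr0 hr1 hrec ⊢
  generalize (k : ℝ)⁻¹ = r at *
  suffices h : ∀ i : ℕ, i ≤ k →
      ((i : ℝ) * r) * ((1 - r) ^ (i - 1) - ε) * F - 4 * i * ξ ≤ a i from fun i _ hi => h i hi
  intro i
  induction i with
  | zero => intro _; simpa using ha0
  | succ i ih =>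
    intro hi
    have hstep := hrec (i + 1) (by omega) hi
    have hmul := mul_le_mul_of_nonneg_left (ih (by omega)) (sub_nonneg.2 hr1)
    have hpow : (i : ℝ) * ((1 - r) ^ (i - 1) * (1 - r)) = i * (1 - r) ^ i := by
      cases i with
      | zero => simp
      | succ n => simp [pow_succ]
    have hεF : 0 ≤ (i : ℝ) * r * r * ε * F := by positivity
    have hξr : 0 ≤ 4 * (i : ℝ) * ξ * r := by positivity
    simp only [Nat.add_sub_cancel] at hstep ⊢
    push_cast
    linear_combination hstep + hmul + hεF + hξr - r * F * hpow
end

section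
/- Let k be a positive natural number, let F ≥ 0, ε ≥ 0, ξ ≥ 0 be reals, and let a : ℕ → ℝ satisfy a(0) ≥ 0 and, for every i with 1 ≤ i ≤ k, a(i) ≥ a(i−1) + ( ((1 − 1/k)^{i−1} − ε)·F − a(i−1) )/k − 4·ξ. Then a(k) ≥ (e^{−1} − ε)·F − 4·k·ξ. (This is the conclusion of the resilience proof of RandomSampling, Lemma E.4: its output S_k satisfies E[f(S_k)] ≥ (1/e − ε)·f(OPT) − 4kξ, i.e. RandomSampling is a (1/e, 2, 1, n, 4k)-resilient approximation for non-monotone submodular maximization under a cardinality constraint k.) -/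
theorem exp_neg_one_le_one_sub_inv_pow (m : ℕ) :
    Real.exp (-1) ≤ (1 - 1 / ((m + 1 : ℕ) : ℝ)) ^ m := by
  rcases Nat.eq_zero_or_pos m with rfl | hm
  · simp
  have hm' : (0 : ℝ) < m := by exact_mod_cast hm
  have hbase : Real.exp (-(1 / (m : ℝ))) ≤ 1 - 1 / ((m + 1 : ℕ) : ℝ) := by
    have h := Real.add_one_le_exp (1 / (m : ℝ))
    have heq : 1 - 1 / ((m + 1 : ℕ) : ℝ) = (1 / (m : ℝ) + 1)⁻¹ := by
      push_cast
      field_simp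
      ring
    rw [Real.exp_neg, heq]
    exact inv_anti₀ (by positivity) h
  calc Real.exp (-1) = Real.exp (-(1 / (m : ℝ))) ^ m := by
        rw [← Real.exp_nat_mul]
        congr 1
        field_simp
    _ ≤ _ := pow_le_pow_left₀ (Real.exp_pos _).le hbase m

/-- Unrolling `x (i + 1) ≥ q * x i + q ^ i * c - d` gives `x i ≥ i * q ^ (i - 1) * c - i * d`. -/
theorem lower_bound_of_affine_recurrence {q c d : ℝ} (hq1 : q ≤ 1) (hq0 : 0 ≤ q)
    (hd : 0 ≤ d) {x : ℕ → ℝ} {n : ℕ} (hx0 : 0 ≤ x 0)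
    (hx : ∀ i < n, q * x i + q ^ i * c - d ≤ x (i + 1)) :
    ∀ i ≤ n, i * q ^ (i - 1) * c - i * d ≤ x i := by
  intro i
  induction i with
  | zero => intro _; simpa using hx0
  | succ i ih =>
    intro hi
    have hmul := mul_le_mul_of_nonneg_left (ih (by omega)) hq0
    have hpow : (i : ℝ) * (q * q ^ (i - 1)) = i * q ^ i := by
      rcases i with _ | j
      · simp
      · rw [Nat.add_sub_cancel, pow_succ']
    have hdrop : q * (i * d) ≤ i * d := mul_le_of_le_one_left (by positivity) hq1
    have hexpand : q * (i * q ^ (i - 1) * c - i * d) = i * q ^ i * c - q * (i * d) := by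
      rw [← hpow]; ring
    have hstep := hx i hi
    rw [Nat.add_sub_cancel]
    push_cast
    linarith

theorem stmt_14 (k : ℕ) (hk : 0 < k)
    (F ε ξ : ℝ) (hF : 0 ≤ F) (hε : 0 ≤ ε) (hξ : 0 ≤ ξ)
    (a : ℕ → ℝ) (ha0 : 0 ≤ a 0)
    (hrec : ∀ i : ℕ, 1 ≤ i → i ≤ k →
      a (i - 1) + (((1 - 1 / (k : ℝ)) ^ (i - 1) - ε) * F - a (i - 1)) / k - 4 * ξ ≤ a i) :
    (Real.exp (-1) - ε) * F - 4 * k * ξ ≤ a k := by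
  have hk1 : (1 : ℝ) ≤ k := by exact_mod_cast hk
  have hk0 : (k : ℝ) ≠ 0 := by positivity
  have hinv : 1 / (k : ℝ) ≤ 1 := by rw [div_le_one (by positivity)]; exact hk1
  have hinv0 : 0 ≤ 1 / (k : ℝ) := by positivity
  have hbound := lower_bound_of_affine_recurrence (q := 1 - 1 / (k : ℝ)) (c := F / k)
    (d := ε * F / k + 4 * ξ) (by linarith) (by linarith) (by positivity) ha0 (n := k)
    (fun i hi => by
      have h := hrec (i + 1) (by omega) hi
      rw [Nat.add_sub_cancel] at h
      refine le_trans (le_of_eq ?_) h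
      ring) k le_rfl
  have hexp : Real.exp (-1) ≤ (1 - 1 / (k : ℝ)) ^ (k - 1) := by
    have h := exp_neg_one_le_one_sub_inv_pow (k - 1)
    rwa [Nat.sub_add_cancel hk] at h
  have hexpF := mul_le_mul_of_nonneg_right hexp hF
  have hsimp : (k : ℝ) * (1 - 1 / (k : ℝ)) ^ (k - 1) * (F / k) - k * (ε * F / k + 4 * ξ)
      = (1 - 1 / (k : ℝ)) ^ (k - 1) * F - ε * F - 4 * k * ξ := by
    generalize (1 - 1 / (k : ℝ)) ^ (k - 1) = p
    field_simp
    ring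
  linarith
end
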